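/- The generating function Σ over indices k and integers a ≥ 2 of ζ*(k,a) A^{dep k} W^{|k|+a} equals W(ψ₁((1+A)W) − ψ₁(AW)) in 𝒵[A][[W]], where ψ₁(W) = Σ_{k≥2} ζ(k)W^{k-1}. -/

import Mathlib

open PowerSeries

/-- The multiple zeta-star value `ζ*(k₁,…,k_r)`. -/
noncomputable def mzvStar (ks : List ℕ) : ℝ :=
  ∑' f : {f : Fin ks.length → ℕ+ // Monotone f},
    ∏ i : Fin ks.length, ((f.1 i : ℝ) ^ ks.get i)⁻¹

/-- The Riemann zeta value `ζ(k)`. -/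
noncomputable def zetaVal (k : ℕ) : ℝ := ∑' n : ℕ+, ((n : ℝ) ^ k)⁻¹

/-- `ψ₁(pW) = Σ_{k ≥ 2} ζ(k) p^{k-1} W^{k-1}` for a polynomial `p` in the variable `A`. -/
noncomputable def psi1At (p : Polynomial ℝ) : PowerSeries (Polynomial ℝ) :=
  PowerSeries.mk fun n => if n = 0 then 0 else Polynomial.C (zetaVal (n + 1)) * p ^ n

open scoped ENNReal

/-- The tail sum `∑_{m ≤ n₁ ≤ ⋯ ≤ n_r} ∏ nᵢ ^ (-kᵢ)` in `[0, ∞]`. -/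
noncomputable def starTail : List ℕ → ℕ → ℝ≥0∞
  | [], _ => 1
  | a :: l, m => ∑' i : ℕ, ENNReal.ofReal ((((m + i : ℕ) : ℝ) ^ a)⁻¹) * starTail l (m + i)

lemma tsum_pnat_ge (f : ℕ → ℝ≥0∞) {m : ℕ} (hm : 1 ≤ m) :
    ∑' n : ℕ+, (if m ≤ (n : ℕ) then f n else 0) = ∑' i : ℕ, f (m + i) := by
  let e : ℕ → ℕ+ := fun i => ⟨m + i, by omega⟩
  have hinj : Function.Injective e := by
    intro i j h
    have := congrArg PNat.val h
    simp only [e, PNat.mk_coe] at this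
    omega
  rw [← hinj.tsum_eq]
  · simp [e]
  · intro n hn
    have h : m ≤ (n : ℕ) := by
      by_contra h
      simp [h] at hn
    exact ⟨n - m, PNat.eq (by simp [e]; omega)⟩

lemma monotone_cons_and_ge_iff {r : ℕ} (n : ℕ+) (g : Fin r → ℕ+) (m : ℕ) :
    (Monotone (Fin.cons n g : Fin (r + 1) → ℕ+) ∧
        ∀ i, m ≤ ((Fin.cons n g : Fin (r + 1) → ℕ+) i : ℕ)) ↔
      m ≤ (n : ℕ) ∧ Monotone g ∧ ∀ i, (n : ℕ) ≤ (g i : ℕ) := by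
  constructor
  · rintro ⟨h1, h2⟩
    refine ⟨by simpa using h2 0, fun i j hij => ?_, fun i => ?_⟩
    · simpa using h1 (Fin.succ_le_succ_iff.2 hij)
    · simpa using h1 (Fin.zero_le i.succ)
  · rintro ⟨h1, h2, h3⟩
    refine ⟨fun i j => ?_, fun i => ?_⟩
    · refine Fin.cases ?_ (fun i => ?_) i <;> refine Fin.cases ?_ (fun j => ?_) j
      · simp
      · intro _; simpa using h3 j
      · intro h; simp at h
      · intro h; simpa using h2 (Fin.succ_le_succ_iff.1 h)
    · refine Fin.cases ?_ (fun i => ?_) i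
      · simpa using h1
      · simpa using h1.trans (h3 i)

open Classical in
lemma tsum_monotone_ge_eq_starTail (l : List ℕ) {m : ℕ} (hm : 1 ≤ m) :
    ∑' f : Fin l.length → ℕ+, (if Monotone f ∧ ∀ i, m ≤ (f i : ℕ) then
      ∏ i, ENNReal.ofReal (((f i : ℝ) ^ l.get i)⁻¹) else 0) = starTail l m := by
  induction l generalizing m with
  | nil =>
    have : ∀ f : Fin ([] : List ℕ).length → ℕ+, Monotone f := fun f i => i.elim0
    have h2 : ∀ f : Fin ([] : List ℕ).length → ℕ+, ∀ i, m ≤ (f i : ℕ) := fun f i => i.elim0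
    simp only [this, h2, implies_true, and_self, if_true, starTail]
    have : Unique (Fin ([] : List ℕ).length → ℕ+) := inferInstanceAs (Unique (Fin 0 → ℕ+))
    rw [tsum_eq_single default fun f hf => (hf (Subsingleton.elim _ _)).elim]
    simp
  | cons a l ih =>
    rw [starTail, ← tsum_pnat_ge (fun n => ENNReal.ofReal (((n : ℝ) ^ a)⁻¹) * starTail l n) hm]
    refine ((Fin.consEquiv (fun _ : Fin (l.length + 1) => ℕ+)).tsum_eq _).symm.trans ?_
    rw [ENNReal.tsum_prod']
    refine tsum_congr fun n => ?_
    change ∑' g : Fin l.length → ℕ+, (if Monotone (Fin.cons n g : Fin (l.length + 1) → ℕ+) ∧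
      ∀ i, m ≤ ((Fin.cons n g : Fin (l.length + 1) → ℕ+) i : ℕ) then
        ∏ i : Fin (l.length + 1), ENNReal.ofReal
          ((((Fin.cons n g : Fin (l.length + 1) → ℕ+) i : ℝ) ^ (a :: l).get i)⁻¹) else 0) = _
    simp only [monotone_cons_and_ge_iff]
    by_cases h : m ≤ (n : ℕ)
    · simp only [h, true_and, if_true]
      rw [← ih n.pos, ← ENNReal.tsum_mul_left]
      refine tsum_congr fun g => ?_
      rw [mul_ite, mul_zero]
      congr 1
      rw [Fin.prod_univ_succ]
      simp
    · simp [h]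

lemma mzvStar_eq_toReal (l : List ℕ) : mzvStar l = (starTail l 1).toReal := by
  classical
  rw [← tsum_monotone_ge_eq_starTail l le_rfl, mzvStar]
  have h : ∀ f : Fin l.length → ℕ+, (Monotone f ∧ ∀ i, 1 ≤ (f i : ℕ)) ↔
      f ∈ {f : Fin l.length → ℕ+ | Monotone f} :=
    fun f => ⟨fun h => h.1, fun h => ⟨h, fun i => (f i).pos⟩⟩
  simp only [h]
  have := tsum_subtype {f : Fin l.length → ℕ+ | Monotone f}
    (fun f => ∏ i, ENNReal.ofReal (((f i : ℝ) ^ l.get i)⁻¹))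
  simp only [Set.indicator_apply] at this
  rw [← this, ENNReal.tsum_toReal_eq]
  · refine tsum_congr fun f => ?_
    rw [ENNReal.toReal_prod]
    refine Finset.prod_congr rfl fun i _ => ?_
    rw [ENNReal.toReal_ofReal (by positivity)]
  · intro f
    exact ENNReal.prod_ne_top fun i _ => ENNReal.ofReal_ne_top

lemma mzvStar_nonneg (l : List ℕ) : 0 ≤ mzvStar l := by
  rw [mzvStar_eq_toReal]
  exact ENNReal.toReal_nonneg

lemma tsum_composition_eq (F : List ℕ → ℝ≥0∞) :
    ∑' w : ℕ, ∑ c : Composition w, F c.blocks =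
      ∑' r : ℕ, ∑' k : Fin r → ℕ+, F (List.ofFn fun i => (k i : ℕ)) := by
  let e : (Σ r : ℕ, Fin r → ℕ+) → Σ w : ℕ, Composition w := fun x =>
    ⟨(List.ofFn fun i => (x.2 i : ℕ)).sum, ⟨List.ofFn fun i => (x.2 i : ℕ), by
      intro i hi
      obtain ⟨j, rfl⟩ := (List.mem_ofFn' _ _).1 hi
      exact (x.2 j).pos, rfl⟩⟩
  have he : Function.Bijective e := by
    constructor
    · rintro ⟨r, k⟩ ⟨s, k'⟩ h
      have hb : List.ofFn (fun i => (k i : ℕ)) = List.ofFn (fun i => (k' i : ℕ)) :=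
        congrArg (fun y : Σ w : ℕ, Composition w => y.2.blocks) h
      have hl : r = s := by simpa using congrArg List.length hb
      subst hl
      have := List.ofFn_injective hb
      congr 1
      funext i
      exact PNat.eq (congrFun this i)
    · rintro ⟨w, ⟨l, hpos, rfl⟩⟩
      refine ⟨⟨l.length, fun i => ⟨l.get i, hpos (List.get_mem _ _)⟩⟩, ?_⟩
      simp only [e, PNat.mk_coe]
      have h : List.ofFn (fun i : Fin l.length => l.get i) = l := List.ofFn_get l
      congr! 1
      · rw [h]
      · congr! 1
  have h1 : ∑' x : Σ w : ℕ, Composition w, F x.2.blocks =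
      ∑' x : Σ r : ℕ, Fin r → ℕ+, F (List.ofFn fun i => (x.2 i : ℕ)) :=
    ((Equiv.ofBijective e he).tsum_eq (fun x => F x.2.blocks)).symm
  rw [ENNReal.tsum_sigma', ENNReal.tsum_sigma'] at h1
  simpa only [tsum_fintype] using h1

/-- The weight of a list of indices: `A ^ (r - 1) W ^ (k₁ + ⋯ + k_r)` times the tail sum from `m`,
provided that the last index is at least two. -/
noncomputable def starWeight (A W : ℝ) (m : ℕ) (l : List ℕ) : ℝ≥0∞ :=
  if 2 ≤ l.getLastD 0 then
    ENNReal.ofReal (A ^ (l.length - 1) * W ^ l.sum) * starTail l m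
  else 0

lemma starWeight_cons {A W : ℝ} (hA : 0 ≤ A) (hW : 0 ≤ W) (m a : ℕ) {l : List ℕ} (hl : l ≠ []) :
    starWeight A W m (a :: l) =
      ∑' i : ℕ, ENNReal.ofReal (A * (W / ((m + i : ℕ) : ℝ)) ^ a) * starWeight A W (m + i) l := by
  obtain ⟨b, l, rfl⟩ := List.exists_cons_of_ne_nil hl
  have h : (a :: b :: l).getLastD 0 = (b :: l).getLastD 0 := by
    simp only [List.getLastD_cons]
  unfold starWeight
  rw [h]
  split_ifs with h2
  · rw [starTail, ← ENNReal.tsum_mul_left]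
    refine tsum_congr fun i => ?_
    rw [← mul_assoc, ← mul_assoc, ← ENNReal.ofReal_mul (by positivity),
      ← ENNReal.ofReal_mul (by positivity)]
    congr 2
    simp only [List.length_cons, List.sum_cons, Nat.add_sub_cancel, div_pow]
    ring
  · simp

/-- The sum of the weights over all lists of `r + 1` positive indices. -/
noncomputable def depthSum (A W : ℝ) (r m : ℕ) : ℝ≥0∞ :=
  ∑' k : Fin (r + 1) → ℕ+, starWeight A W m (List.ofFn fun i => (k i : ℕ))

lemma tsum_pnat_ofReal_pow {x : ℝ} (hx : 0 ≤ x) (hx1 : x < 1) (j : ℕ) (hj : 1 ≤ j) :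
    ∑' a : ℕ+, (if j ≤ (a : ℕ) then ENNReal.ofReal (x ^ (a : ℕ)) else 0) =
      ENNReal.ofReal (x ^ j / (1 - x)) := by
  rw [tsum_pnat_ge (fun a => ENNReal.ofReal (x ^ a)) hj,
    ← ENNReal.ofReal_tsum_of_nonneg (fun i => by positivity)]
  · simp only [pow_add]
    rw [tsum_mul_left, tsum_geometric_of_lt_one hx hx1, div_eq_mul_inv]
  · simp only [pow_add]
    exact (summable_geometric_of_lt_one hx hx1).mul_left _

lemma depthSum_zero {A W : ℝ} (hW : 0 ≤ W) (hW1 : W < 1) {m : ℕ} (hm : 1 ≤ m) :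
    depthSum A W 0 m =
      ∑' i : ℕ, ENNReal.ofReal (W ^ 2 / (((m + i : ℕ) : ℝ) * (((m + i : ℕ) : ℝ) - W))) := by
  rw [depthSum, ← (Equiv.funUnique (Fin 1) ℕ+).symm.tsum_eq]
  have h : ∀ a : ℕ+, starWeight A W m
      (List.ofFn fun i => (((Equiv.funUnique (Fin 1) ℕ+).symm a i : ℕ+) : ℕ)) =
      ∑' i : ℕ, (if 2 ≤ (a : ℕ) then
        ENNReal.ofReal ((W / ((m + i : ℕ) : ℝ)) ^ (a : ℕ)) else 0) := by
    intro a
    have : (List.ofFn fun i => (((Equiv.funUnique (Fin 1) ℕ+).symm a i : ℕ+) : ℕ)) = [(a : ℕ)] := by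
      simp
    rw [this, starWeight]
    split_ifs with h1 h2 h2
    · simp only [starTail]
      rw [← ENNReal.tsum_mul_left]
      refine tsum_congr fun i => ?_
      rw [mul_one, ← ENNReal.ofReal_mul (by simp; positivity)]
      simp [div_eq_mul_inv, mul_pow]
    · simp at h1; omega
    · simp at h1; omega
    · simp
  simp only [h]
  rw [ENNReal.tsum_comm]
  refine tsum_congr fun i => ?_
  have hn : (1 : ℝ) ≤ ((m + i : ℕ) : ℝ) := by exact_mod_cast (by omega)
  have hn0 : (0 : ℝ) < ((m + i : ℕ) : ℝ) - W := by linarith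
  rw [tsum_pnat_ofReal_pow (by positivity) ((div_lt_one (by linarith)).2 (by linarith)) 2 one_le_two]
  congr 1
  generalize ((m + i : ℕ) : ℝ) = n at *
  have : n ≠ 0 := by linarith
  have : n - W ≠ 0 := hn0.ne'
  have : 1 - W / n ≠ 0 := by
    rw [one_sub_div (by assumption)]
    positivity
  field_simp

lemma depthSum_succ {A W : ℝ} (hA : 0 ≤ A) (hW : 0 ≤ W) (hW1 : W < 1) (r : ℕ) {m : ℕ}
    (hm : 1 ≤ m) :
    depthSum A W (r + 1) m =
      ∑' i : ℕ, ENNReal.ofReal (A * W / (((m + i : ℕ) : ℝ) - W)) * depthSum A W r (m + i) := by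
  rw [depthSum]
  refine ((Fin.consEquiv (fun _ : Fin (r + 1 + 1) => ℕ+)).tsum_eq _).symm.trans ?_
  rw [ENNReal.tsum_prod']
  have h : ∀ (a : ℕ+) (k : Fin (r + 1) → ℕ+),
      starWeight A W m (List.ofFn fun i =>
        ((Fin.consEquiv (fun _ : Fin (r + 1 + 1) => ℕ+) (a, k) i : ℕ+) : ℕ)) =
      ∑' i : ℕ, ENNReal.ofReal (A * (W / ((m + i : ℕ) : ℝ)) ^ (a : ℕ)) *
        starWeight A W (m + i) (List.ofFn fun i => (k i : ℕ)) := by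
    intro a k
    rw [← starWeight_cons hA hW _ _ (by simp), List.ofFn_succ]
    simp [Fin.consEquiv_apply]
  simp only [h]
  have h2 : ∀ a : ℕ+, ∑' (k : Fin (r + 1) → ℕ+) (i : ℕ),
      ENNReal.ofReal (A * (W / ((m + i : ℕ) : ℝ)) ^ (a : ℕ)) *
        starWeight A W (m + i) (List.ofFn fun i => (k i : ℕ)) =
      ∑' i : ℕ, ENNReal.ofReal (A * (W / ((m + i : ℕ) : ℝ)) ^ (a : ℕ)) *
        depthSum A W r (m + i) := by
    intro a
    rw [ENNReal.tsum_comm]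
    refine tsum_congr fun i => ?_
    rw [ENNReal.tsum_mul_left, depthSum]
  simp only [h2]
  rw [ENNReal.tsum_comm]
  refine tsum_congr fun i => ?_
  rw [ENNReal.tsum_mul_right]
  congr 1
  have hn : (1 : ℝ) ≤ ((m + i : ℕ) : ℝ) := by exact_mod_cast (by omega)
  generalize ((m + i : ℕ) : ℝ) = n at *
  have h3 := tsum_pnat_ofReal_pow (x := W / n) (by positivity)
    ((div_lt_one (by linarith)).2 (by linarith)) 1 le_rfl
  have h4 : ∀ a : ℕ+, 1 ≤ (a : ℕ) := fun a => a.pos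
  simp only [h4, if_true] at h3
  simp only [ENNReal.ofReal_mul hA]
  rw [ENNReal.tsum_mul_left, h3, ← ENNReal.ofReal_mul hA]
  congr 1
  have : n ≠ 0 := by linarith
  have : n - W ≠ 0 := by linarith
  have : 1 - W / n ≠ 0 := by
    rw [one_sub_div (by assumption)]
    positivity
  field_simp

/-- The `i`-th term of the product form of the generating function started at `m`. -/
noncomputable def prodTerm (A W : ℝ) (m i : ℕ) : ℝ :=
  W ^ 2 / (((m + i : ℕ) : ℝ) * (((m + i : ℕ) : ℝ) - W)) *
    ∏ j ∈ Finset.range (i + 1),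
      (((m + j : ℕ) : ℝ) - W) / (((m + j : ℕ) : ℝ) - (1 + A) * W)

lemma prodTerm_zero (A W : ℝ) (m : ℕ) :
    prodTerm A W m 0 = ((m : ℝ) - W) / ((m : ℝ) - (1 + A) * W) * (W ^ 2 / (m * (m - W))) := by
  simp [prodTerm, mul_comm]

lemma prodTerm_succ (A W : ℝ) (m i : ℕ) :
    prodTerm A W m (i + 1) =
      ((m : ℝ) - W) / ((m : ℝ) - (1 + A) * W) * prodTerm A W (m + 1) i := by
  rw [prodTerm, prodTerm, Finset.prod_range_succ', show m + (i + 1) = m + 1 + i by ring]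
  simp only [← add_assoc, add_right_comm m _ 1, add_zero]
  ring

/-- The sum of the product form of the generating function started at `m`. -/
noncomputable def prodSum (A W : ℝ) (m : ℕ) : ℝ≥0∞ :=
  ∑' i : ℕ, ENNReal.ofReal (prodTerm A W m i)

lemma prodSum_eq {A W : ℝ} (hA : 0 ≤ A) (hW : 0 ≤ W) (hAW : (1 + A) * W < 1) {m : ℕ} (hm : 1 ≤ m) :
    prodSum A W m = ENNReal.ofReal (((m : ℝ) - W) / ((m : ℝ) - (1 + A) * W)) *
      (ENNReal.ofReal (W ^ 2 / (m * (m - W))) + prodSum A W (m + 1)) := by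
  have hm' : (1 : ℝ) ≤ m := by exact_mod_cast hm
  have h0 : 0 ≤ A * W := by positivity
  have h1 : 0 < (m : ℝ) - (1 + A) * W := by linarith
  have h2 : 0 < (m : ℝ) - W := by linarith
  rw [prodSum, tsum_eq_zero_add' ENNReal.summable, prodTerm_zero, mul_add, prodSum,
    ← ENNReal.tsum_mul_left, ENNReal.ofReal_mul (by positivity)]
  congr 1
  refine tsum_congr fun i => ?_
  rw [prodTerm_succ, ENNReal.ofReal_mul (by positivity)]

lemma prodSum_eq_add {A W : ℝ} (hA : 0 ≤ A) (hW : 0 ≤ W) (hAW : (1 + A) * W < 1) {m : ℕ}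
    (hm : 1 ≤ m) :
    prodSum A W m = ENNReal.ofReal (W ^ 2 / (m * (m - W))) +
      ENNReal.ofReal (A * W / (m - W)) * prodSum A W m + prodSum A W (m + 1) := by
  have hm' : (1 : ℝ) ≤ m := by exact_mod_cast hm
  have h0 : 0 ≤ A * W := by positivity
  have h1 : 0 < (m : ℝ) - (1 + A) * W := by linarith
  have h2 : 0 < (m : ℝ) - W := by linarith
  have h : ENNReal.ofReal (((m : ℝ) - W) / ((m : ℝ) - (1 + A) * W)) =
      1 + ENNReal.ofReal (A * W / (m - W)) *
        ENNReal.ofReal (((m : ℝ) - W) / ((m : ℝ) - (1 + A) * W)) := by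
    rw [← ENNReal.ofReal_mul (by positivity), ← ENNReal.ofReal_one,
      ← ENNReal.ofReal_add zero_le_one (by positivity)]
    congr 1
    generalize (m : ℝ) = n at *
    rw [div_mul_div_cancel₀ h2.ne', eq_comm, ← eq_sub_iff_add_eq', eq_comm, div_sub_one h1.ne']
    ring
  conv_lhs => rw [prodSum_eq hA hW hAW hm, h]
  conv_rhs => rw [prodSum_eq hA hW hAW hm]
  ring

lemma tsum_le_of_add_le {f H : ℕ → ℝ≥0∞} {m : ℕ}
    (h : ∀ n, m ≤ n → f n + H (n + 1) ≤ H n) : ∑' i : ℕ, f (m + i) ≤ H m := by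
  refine ENNReal.tsum_le_of_sum_range_le fun N => ?_
  suffices ∑ i ∈ Finset.range N, f (m + i) + H (m + N) ≤ H m from le_self_add.trans this
  induction N with
  | zero => simp
  | succ N ih =>
    rw [Finset.sum_range_succ, add_assoc]
    exact (add_le_add_right (h (m + N) (by omega)) _).trans ih

lemma sum_depthSum_le {A W : ℝ} (hA : 0 ≤ A) (hW : 0 ≤ W) (hAW : (1 + A) * W < 1) (R : ℕ) {m : ℕ}
    (hm : 1 ≤ m) : ∑ r ∈ Finset.range R, depthSum A W r m ≤ prodSum A W m := by
  have h0 : 0 ≤ A * W := by positivity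
  have hW1 : W < 1 := by linarith
  induction R generalizing m with
  | zero => simp
  | succ R ih =>
    rw [Finset.sum_range_succ', depthSum_zero hW hW1 hm]
    simp only [depthSum_succ hA hW hW1 _ hm]
    rw [← Summable.tsum_finsetSum (fun _ _ => ENNReal.summable), ← ENNReal.tsum_add]
    refine tsum_le_of_add_le (f := fun n =>
      ∑ r ∈ Finset.range R, ENNReal.ofReal (A * W / ((n : ℝ) - W)) * depthSum A W r n +
        ENNReal.ofReal (W ^ 2 / ((n : ℝ) * ((n : ℝ) - W)))) fun n hn => ?_
    rw [← Finset.mul_sum]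
    conv_rhs => rw [prodSum_eq_add hA hW hAW (hm.trans hn)]
    rw [add_comm (ENNReal.ofReal _ * _)]
    gcongr
    exact ih (hm.trans hn)

lemma tsum_depthSum_eq {A W : ℝ} (hA : 0 ≤ A) (hW : 0 ≤ W) (hW1 : W < 1) {m : ℕ} (hm : 1 ≤ m) :
    ∑' r, depthSum A W r m = ENNReal.ofReal (W ^ 2 / (m * (m - W))) +
      ENNReal.ofReal (A * W / (m - W)) * ∑' r, depthSum A W r m +
        ∑' r, depthSum A W r (m + 1) := by
  have key : ∀ n, 1 ≤ n → ∑' r, depthSum A W r n = ∑' i : ℕ,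
      (ENNReal.ofReal (W ^ 2 / (((n + i : ℕ) : ℝ) * (((n + i : ℕ) : ℝ) - W))) +
        ENNReal.ofReal (A * W / (((n + i : ℕ) : ℝ) - W)) * ∑' r, depthSum A W r (n + i)) := by
    intro n hn
    rw [tsum_eq_zero_add' ENNReal.summable, depthSum_zero hW hW1 hn, ENNReal.tsum_add]
    congr 1
    simp only [depthSum_succ hA hW hW1 _ hn]
    rw [ENNReal.tsum_comm]
    simp only [ENNReal.tsum_mul_left]
  conv_lhs => rw [key m hm, tsum_eq_zero_add' ENNReal.summable]
  rw [key (m + 1) (by omega)]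
  simp only [← add_assoc, add_right_comm m _ 1, add_zero]

lemma prodSum_le_of_eq_add {A W : ℝ} (hA : 0 ≤ A) (hW : 0 ≤ W) (hAW : (1 + A) * W < 1)
    {T : ℕ → ℝ≥0∞}
    (hT : ∀ m : ℕ, 1 ≤ m → T m = ENNReal.ofReal (W ^ 2 / (m * (m - W))) +
      ENNReal.ofReal (A * W / (m - W)) * T m + T (m + 1)) {m : ℕ} (hm : 1 ≤ m) :
    prodSum A W m ≤ T m := by
  have h0 : 0 ≤ A * W := by positivity
  have step : ∀ m : ℕ, 1 ≤ m → ENNReal.ofReal (((m : ℝ) - W) / ((m : ℝ) - (1 + A) * W)) *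
      (ENNReal.ofReal (W ^ 2 / (m * (m - W))) + T (m + 1)) ≤ T m := by
    intro m hm
    have hm' : (1 : ℝ) ≤ m := by exact_mod_cast hm
    have h1 : 0 < (m : ℝ) - (1 + A) * W := by linarith
    have h2 : 0 < (m : ℝ) - W := by linarith
    by_cases htop : T m = ⊤
    · rw [htop]; exact le_top
    have hle := hT m hm
    have hsplit : T m = ENNReal.ofReal (A * W / (m - W)) * T m +
        ENNReal.ofReal (((m : ℝ) - (1 + A) * W) / ((m : ℝ) - W)) * T m := by
      rw [← add_mul, ← ENNReal.ofReal_add (by positivity) (by positivity), ← add_div,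
        show A * W + ((m : ℝ) - (1 + A) * W) = m - W by ring, div_self h2.ne']
      simp
    have hcancel : ENNReal.ofReal (W ^ 2 / (m * (m - W))) + T (m + 1) =
        ENNReal.ofReal (((m : ℝ) - (1 + A) * W) / ((m : ℝ) - W)) * T m := by
      have hfin : ENNReal.ofReal (A * W / (m - W)) * T m ≠ ⊤ :=
        ENNReal.mul_ne_top ENNReal.ofReal_ne_top htop
      rw [← ENNReal.add_right_inj hfin, ← hsplit]
      conv_rhs => rw [hle]
      ring
    rw [hcancel, ← mul_assoc, ← ENNReal.ofReal_mul (by positivity),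
      div_mul_div_cancel₀ h1.ne', div_self h2.ne']
    simp
  refine ENNReal.tsum_le_of_sum_range_le fun N => ?_
  induction N generalizing m with
  | zero => simp
  | succ N ih =>
    have hm' : (1 : ℝ) ≤ m := by exact_mod_cast hm
    have h1 : 0 < (m : ℝ) - (1 + A) * W := by linarith
    have h2 : 0 < (m : ℝ) - W := by linarith
    refine le_trans ?_ (step m hm)
    rw [Finset.sum_range_succ', prodTerm_zero, ENNReal.ofReal_mul (by positivity), add_comm, mul_add]
    simp only [prodTerm_succ]
    gcongr
    simp only [ENNReal.ofReal_mul (show 0 ≤ ((m : ℝ) - W) / ((m : ℝ) - (1 + A) * W) by positivity)]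
    rw [← Finset.mul_sum]
    gcongr
    exact ih (by omega)

lemma tsum_depthSum_eq_prodSum {A W : ℝ} (hA : 0 ≤ A) (hW : 0 ≤ W) (hAW : (1 + A) * W < 1) {m : ℕ}
    (hm : 1 ≤ m) : ∑' r, depthSum A W r m = prodSum A W m := by
  have h0 : 0 ≤ A * W := by positivity
  refine le_antisymm (ENNReal.tsum_le_of_sum_range_le fun R => sum_depthSum_le hA hW hAW R hm) ?_
  exact prodSum_le_of_eq_add (T := fun m => ∑' r, depthSum A W r m) hA hW hAW
    (fun m hm => tsum_depthSum_eq hA hW (by linarith) hm) hm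

lemma tsum_composition_starWeight {A W : ℝ} (hA : 0 ≤ A) (hW : 0 ≤ W) (hAW : (1 + A) * W < 1) :
    ∑' w : ℕ, ∑ c : Composition w, starWeight A W 1 c.blocks = prodSum A W 1 := by
  rw [tsum_composition_eq, tsum_eq_zero_add' ENNReal.summable,
    ← tsum_depthSum_eq_prodSum hA hW hAW le_rfl]
  simp [depthSum, starWeight]

/-- The ratio of Pochhammer symbols `(1 - W)_i / (y + 1)_i`. -/
noncomputable def pochRatio (W y : ℝ) (i : ℕ) : ℝ :=
  ∏ j ∈ Finset.range i, ((j : ℝ) + 1 - W) / (y + 1 + j)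

section Telescope

variable {W y : ℝ}

lemma pochRatio_succ (W y : ℝ) (i : ℕ) :
    pochRatio W y (i + 1) = pochRatio W y i * (((i : ℝ) + 1 - W) / (y + 1 + i)) :=
  Finset.prod_range_succ _ _

lemma pochRatio_nonneg (hW1 : W ≤ 1) (hy : 1 / 2 ≤ y) (i : ℕ) : 0 ≤ pochRatio W y i := by
  refine Finset.prod_nonneg fun j _ => div_nonneg ?_ ?_
  · have : (0 : ℝ) ≤ j := by positivity
    linarith
  · positivity

lemma pochRatio_sq_mul_le (hW : 0 ≤ W) (hW1 : W ≤ 1) (hy : 1 / 2 ≤ y) (i : ℕ) :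
    pochRatio W y i ^ 2 * (i + 1) ≤ 1 := by
  induction i with
  | zero => simp [pochRatio]
  | succ i ih =>
    refine le_trans ?_ ih
    rw [pochRatio_succ, mul_pow, mul_assoc]
    refine mul_le_mul_of_nonneg_left ?_ (sq_nonneg _)
    have hi : (0 : ℝ) ≤ i := by positivity
    rw [div_pow, div_mul_eq_mul_div, div_le_iff₀ (by positivity)]
    have h1 : ((i : ℝ) + 1 - W) ^ 2 ≤ (i + 1) ^ 2 := by
      apply pow_le_pow_left₀ <;> linarith
    have h2 : ((i : ℝ) + 3 / 2) ^ 2 ≤ (y + 1 + i) ^ 2 := by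
      apply pow_le_pow_left₀ <;> linarith
    push_cast
    calc ((i : ℝ) + 1 - W) ^ 2 * (i + 1 + 1) ≤ (i + 1) ^ 2 * (i + 1 + 1) := by gcongr
      _ ≤ (i + 1) * ((i : ℝ) + 3 / 2) ^ 2 := by nlinarith
      _ ≤ _ := by gcongr

lemma pochRatio_le_one (hW : 0 ≤ W) (hW1 : W ≤ 1) (hy : 1 / 2 ≤ y) (i : ℕ) :
    pochRatio W y i ≤ 1 := by
  have h := pochRatio_sq_mul_le hW hW1 hy i
  have hi : (0 : ℝ) ≤ i := by positivity
  nlinarith [sq_nonneg (pochRatio W y i)]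

lemma tendsto_pochRatio (hW : 0 ≤ W) (hW1 : W ≤ 1) (hy : 1 / 2 ≤ y) :
    Filter.Tendsto (pochRatio W y) Filter.atTop (nhds 0) := by
  have h : Filter.Tendsto (fun i => pochRatio W y i ^ 2) Filter.atTop (nhds 0) := by
    refine squeeze_zero (fun i => sq_nonneg _) (fun i => ?_) tendsto_one_div_add_atTop_nhds_zero_nat
    rw [le_div_iff₀ (by positivity)]
    exact pochRatio_sq_mul_le hW hW1 hy i
  have h2 := h.sqrt
  simp only [Real.sqrt_zero] at h2
  refine h2.congr fun i => Real.sqrt_sq (pochRatio_nonneg hW1 hy i)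

lemma pochRatio_add_one (hy : 1 / 2 ≤ y) (i : ℕ) :
    pochRatio W (y + 1) i = pochRatio W y i * ((y + 1) / (y + 1 + i)) := by
  induction i with
  | zero =>
    have : y + 1 ≠ 0 := by positivity
    simp [pochRatio, this]
  | succ i ih =>
    rw [pochRatio_succ, pochRatio_succ, ih]
    push_cast
    have h1 : y + 1 + i ≠ 0 := by positivity
    have h2 : y + 1 + 1 + i ≠ 0 := by positivity
    have h3 : y + 1 + (i + 1) ≠ 0 := by positivity
    rw [show y + 1 + (i + 1) = y + 1 + 1 + i by ring]
    field_simp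

/-- The general term `W ^ 2 (1 - W)_i / ((i + 1) (y)_{i + 1})`. -/
noncomputable def pochTerm (W y : ℝ) (i : ℕ) : ℝ :=
  W ^ 2 / ((i + 1) * y) * pochRatio W y i

lemma pochTerm_nonneg (hW1 : W ≤ 1) (hy : 1 / 2 ≤ y) (i : ℕ) : 0 ≤ pochTerm W y i := by
  have := pochRatio_nonneg hW1 hy i
  have : 0 < y := by linarith
  unfold pochTerm
  positivity

lemma pochTerm_sub (hW : 0 ≤ W) (hy : 1 / 2 ≤ y) (i : ℕ) :
    pochTerm W y i - pochTerm W (y + 1) i =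
      W ^ 2 / (y * (y + W)) * (pochRatio W y i - pochRatio W y (i + 1)) := by
  unfold pochTerm
  rw [pochRatio_succ, pochRatio_add_one hy]
  have : 0 < y := by linarith
  have h1 : y + 1 + i ≠ 0 := by positivity
  have h2 : y + 1 ≠ 0 := by positivity
  have h3 : y + W ≠ 0 := by positivity
  have h4 : (i : ℝ) + 1 ≠ 0 := by positivity
  field_simp
  ring

lemma pochTerm_eq_mul_sub (hy : 1 / 2 ≤ y) (i : ℕ) :
    pochTerm W y i =
      (y + 1 + i) / (i + 1) * (pochTerm W y i - pochTerm W (y + 1) i) := by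
  unfold pochTerm
  rw [pochRatio_add_one hy]
  have : 0 < y := by linarith
  have h1 : y + 1 + i ≠ 0 := by positivity
  have h2 : y + 1 ≠ 0 := by positivity
  have h4 : (i : ℝ) + 1 ≠ 0 := by positivity
  field_simp
  ring

lemma pochTerm_add_one_le (hW1 : W ≤ 1) (hy : 1 / 2 ≤ y) (i : ℕ) :
    pochTerm W (y + 1) i ≤ pochTerm W y i := by
  have h := pochTerm_eq_mul_sub (W := W) hy i
  have h0 := pochTerm_nonneg hW1 hy i
  have h1 : 0 < (y + 1 + i) / (i + 1) := by positivity
  rw [h] at h0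
  have := nonneg_of_mul_nonneg_right h0 h1
  linarith

lemma hasSum_pochTerm_sub (hW : 0 ≤ W) (hW1 : W ≤ 1) (hy : 1 / 2 ≤ y) :
    HasSum (fun i => pochTerm W y i - pochTerm W (y + 1) i) (W ^ 2 / (y * (y + W))) := by
  rw [hasSum_iff_tendsto_nat_of_nonneg
    (fun i => sub_nonneg.2 (pochTerm_add_one_le hW1 hy i))]
  simp only [pochTerm_sub hW hy, ← Finset.mul_sum, Finset.sum_range_sub']
  have h := ((tendsto_pochRatio hW hW1 hy).const_sub (pochRatio W y 0)).const_mul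
    (W ^ 2 / (y * (y + W)))
  simpa [pochRatio] using h

lemma summable_pochTerm (hW : 0 ≤ W) (hW1 : W ≤ 1) (hy : 1 / 2 ≤ y) :
    Summable (pochTerm W y) := by
  refine Summable.of_nonneg_of_le (pochTerm_nonneg hW1 hy) (fun i => ?_)
    ((hasSum_pochTerm_sub hW hW1 hy).summable.mul_left (y + 1))
  conv_lhs => rw [pochTerm_eq_mul_sub hy]
  refine mul_le_mul_of_nonneg_right ?_ (sub_nonneg.2 (pochTerm_add_one_le hW1 hy i))
  have hi : (0 : ℝ) ≤ i := by positivity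
  rw [div_le_iff₀ (by positivity)]
  nlinarith

lemma tendsto_tsum_pochTerm (hW : 0 ≤ W) (hW1 : W ≤ 1) (hy : 1 / 2 ≤ y) :
    Filter.Tendsto (fun M : ℕ => ∑' i, pochTerm W (y + M) i) Filter.atTop (nhds 0) := by
  have hyM : ∀ M : ℕ, 1 / 2 ≤ y + M := fun M => by
    have : (0 : ℝ) ≤ M := by positivity
    linarith
  have h := tendsto_tsum_of_dominated_convergence (𝓕 := Filter.atTop)
    (f := fun (M : ℕ) i => pochTerm W (y + M) i) (g := fun _ => (0 : ℝ))
    (bound := pochTerm W y) (summable_pochTerm hW hW1 hy) (fun i => ?_)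
    (Filter.Eventually.of_forall fun M i => ?_)
  · simpa using h
  · have hlim : Filter.Tendsto (fun M : ℕ => W ^ 2 / (i + 1) * (y + M)⁻¹) Filter.atTop (nhds 0) := by
      have := (Filter.tendsto_atTop_add_const_left Filter.atTop y
        (tendsto_natCast_atTop_atTop (R := ℝ))).inv_tendsto_atTop.const_mul (W ^ 2 / ((i : ℝ) + 1))
      simpa using this
    refine squeeze_zero (fun M => pochTerm_nonneg hW1 (hyM M) i) (fun M => ?_) hlim
    have h1 := pochRatio_le_one hW hW1 (hyM M) i
    have h2 : 0 < y + M := by linarith [hyM M]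
    calc pochTerm W (y + M) i ≤ W ^ 2 / ((i + 1) * (y + M)) * 1 := by
          unfold pochTerm
          gcongr
      _ = _ := by
          field_simp
  · rw [Real.norm_of_nonneg (pochTerm_nonneg hW1 (hyM M) i)]
    induction M with
    | zero => simp
    | succ M ih =>
      refine le_trans ?_ ih
      rw [Nat.cast_succ, ← add_assoc]
      exact pochTerm_add_one_le hW1 (hyM M) i

lemma hasSum_tsum_pochTerm (hW : 0 ≤ W) (hW1 : W ≤ 1) (hy : 1 / 2 ≤ y) :
    HasSum (fun M : ℕ => W ^ 2 / ((y + M) * (y + M + W))) (∑' i, pochTerm W y i) := by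
  have hyM : ∀ M : ℕ, 1 / 2 ≤ y + M := fun M => by
    have : (0 : ℝ) ≤ M := by positivity
    linarith
  have hy0 : 0 < y := by linarith
  rw [hasSum_iff_tendsto_nat_of_nonneg (fun M => by positivity)]
  have hstep : ∀ M : ℕ, W ^ 2 / ((y + M) * (y + M + W)) =
      ∑' i, pochTerm W (y + M) i - ∑' i, pochTerm W (y + (M + 1 : ℕ)) i := by
    intro M
    rw [← (summable_pochTerm hW hW1 (hyM M)).tsum_sub (summable_pochTerm hW hW1 (hyM (M + 1))),
      ← (hasSum_pochTerm_sub hW hW1 (hyM M)).tsum_eq, Nat.cast_succ, ← add_assoc]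
  simp only [hstep]
  simp only [Finset.sum_range_sub' (fun M : ℕ => ∑' i, pochTerm W (y + M) i)]
  simpa using (tendsto_tsum_pochTerm hW hW1 hy).const_sub (∑' i, pochTerm W y i)

end Telescope

lemma prodTerm_one_eq_pochTerm {A W : ℝ} (hW1 : W < 1) (hAW : (1 + A) * W ≤ 1 / 2) (i : ℕ) :
    prodTerm A W 1 i = pochTerm W (1 - (1 + A) * W) i := by
  have hi : (0 : ℝ) ≤ i := by positivity
  have h1 : 1 - (1 + A) * W ≠ 0 := by linarith
  have h2 : (1 : ℝ) + i - W ≠ 0 := by linarith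
  rw [prodTerm, pochTerm, pochRatio, Finset.prod_div_distrib, Finset.prod_div_distrib,
    Finset.prod_range_succ, Finset.prod_range_succ']
  have h3 : ∏ j ∈ Finset.range i, (((1 + j : ℕ) : ℝ) - W) =
      ∏ j ∈ Finset.range i, ((j : ℝ) + 1 - W) :=
    Finset.prod_congr rfl fun j _ => by push_cast; ring
  have h4 : ∏ j ∈ Finset.range i, (((1 + (j + 1) : ℕ) : ℝ) - (1 + A) * W) =
      ∏ j ∈ Finset.range i, (1 - (1 + A) * W + 1 + j) :=
    Finset.prod_congr rfl fun j _ => by push_cast; ring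
  have h5 : ∏ j ∈ Finset.range i, (1 - (1 + A) * W + 1 + (j : ℝ)) ≠ 0 := by
    refine Finset.prod_ne_zero_iff.2 fun j _ => ?_
    have hj : (0 : ℝ) ≤ j := by positivity
    linarith
  rw [h3, h4]
  generalize ∏ j ∈ Finset.range i, (1 - (1 + A) * W + 1 + (j : ℝ)) = Q at *
  generalize ∏ j ∈ Finset.range i, ((j : ℝ) + 1 - W) = P at *
  push_cast
  rw [add_comm (i : ℝ) 1]
  generalize 1 - (1 + A) * W = y at *
  field_simp

lemma prodSum_one_eq {A W : ℝ} (hW : 0 ≤ W) (hW1 : W < 1) (hAW : (1 + A) * W ≤ 1 / 2) :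
    prodSum A W 1 = ∑' M : ℕ, ENNReal.ofReal
      (W ^ 2 / (((M : ℝ) + 1 - (1 + A) * W) * ((M : ℝ) + 1 - A * W))) := by
  have hy : 1 / 2 ≤ 1 - (1 + A) * W := by linarith
  have h := hasSum_tsum_pochTerm hW hW1.le hy
  rw [prodSum]
  simp only [prodTerm_one_eq_pochTerm hW1 hAW]
  rw [← ENNReal.ofReal_tsum_of_nonneg (pochTerm_nonneg hW1.le hy) (summable_pochTerm hW hW1.le hy),
    ← h.tsum_eq, ENNReal.ofReal_tsum_of_nonneg (fun M => ?_) h.summable]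
  · refine tsum_congr fun M => ?_
    congr 3 <;> ring
  · have : 0 < 1 - (1 + A) * W := by linarith
    positivity

lemma tsum_ofReal_inv_pow_eq_zetaVal {k : ℕ} (hk : 2 ≤ k) :
    ∑' M : ℕ, ENNReal.ofReal ((((M : ℝ) + 1) ^ k)⁻¹) = ENNReal.ofReal (zetaVal k) := by
  have hs : Summable fun M : ℕ => (((M : ℝ) + 1) ^ k)⁻¹ := by
    have := (summable_nat_add_iff 1).2 (Real.summable_nat_pow_inv.2 (show 1 < k by omega))
    simpa using this
  rw [← ENNReal.ofReal_tsum_of_nonneg (fun M => by positivity) hs, zetaVal,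
    tsum_pnat_eq_tsum_succ (f := fun n : ℕ => ((n : ℝ) ^ k)⁻¹)]
  simp

lemma zetaVal_nonneg (k : ℕ) : 0 ≤ zetaVal k := tsum_nonneg fun n => by positivity

/-- The value at `A` of the coefficient of `W ^ w` in `W (ψ₁((1 + A) W) - ψ₁(A W))`. -/
noncomputable def psiCoeff (A : ℝ) : ℕ → ℝ
  | 0 => 0
  | k + 1 => zetaVal (k + 1) * ((1 + A) ^ k - A ^ k)

lemma one_add_pow_sub_pow_nonneg {A : ℝ} (hA : 0 ≤ A) (k : ℕ) : 0 ≤ (1 + A) ^ k - A ^ k :=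
  sub_nonneg.2 (pow_le_pow_left₀ hA (by linarith) k)

lemma psiCoeff_nonneg {A : ℝ} (hA : 0 ≤ A) (w : ℕ) : 0 ≤ psiCoeff A w := by
  cases w with
  | zero => exact le_rfl
  | succ k => exact mul_nonneg (zetaVal_nonneg _) (one_add_pow_sub_pow_nonneg hA k)

lemma hasSum_geometric_div {x n : ℝ} (hx : 0 ≤ x) (hxn : x < n) :
    HasSum (fun k : ℕ => x ^ k * (n ^ (k + 1))⁻¹) (1 / (n - x)) := by
  have hn : 0 < n := by linarith
  have h := (hasSum_geometric_of_lt_one (r := x / n) (by positivity)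
    ((div_lt_one hn).2 hxn)).mul_left n⁻¹
  have h2 : n - x ≠ 0 := by linarith
  have h3 : n⁻¹ * (1 - x / n)⁻¹ = 1 / (n - x) := by
    rw [one_sub_div hn.ne']
    field_simp
  rw [h3] at h
  have h4 : (fun k : ℕ => x ^ k * (n ^ (k + 1))⁻¹) = fun k => n⁻¹ * (x / n) ^ k := by
    funext k
    rw [div_pow, pow_succ]
    field_simp
  rwa [h4]

lemma tsum_psiCoeff {A W : ℝ} (hA : 0 ≤ A) (hW : 0 ≤ W) (hAW : (1 + A) * W < 1) :
    ∑' M : ℕ, ENNReal.ofReal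
      (W ^ 2 / (((M : ℝ) + 1 - (1 + A) * W) * ((M : ℝ) + 1 - A * W))) =
      ∑' w : ℕ, ENNReal.ofReal (psiCoeff A w * W ^ w) := by
  have h0 : 0 ≤ A * W := by positivity
  have h1 : ∀ M : ℕ, ENNReal.ofReal
      (W ^ 2 / (((M : ℝ) + 1 - (1 + A) * W) * ((M : ℝ) + 1 - A * W))) =
      ∑' k : ℕ, ENNReal.ofReal (((1 + A) ^ k - A ^ k) * W ^ (k + 1)) *
        ENNReal.ofReal ((((M : ℝ) + 1) ^ (k + 1))⁻¹) := by
    intro M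
    have hM : (0 : ℝ) ≤ M := by positivity
    have h2 : (M : ℝ) + 1 - (1 + A) * W ≠ 0 := by linarith
    have h3 : (M : ℝ) + 1 - A * W ≠ 0 := by linarith
    have hs := ((hasSum_geometric_div (x := (1 + A) * W) (n := M + 1) (by positivity)
      (by linarith)).sub (hasSum_geometric_div (x := A * W) (n := M + 1) h0
      (by linarith))).mul_left W
    have he : W ^ 2 / (((M : ℝ) + 1 - (1 + A) * W) * ((M : ℝ) + 1 - A * W)) =
        W * (1 / ((M : ℝ) + 1 - (1 + A) * W) - 1 / ((M : ℝ) + 1 - A * W)) := by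
      rw [div_sub_div _ _ h2 h3]
      ring
    have hf : ∀ k : ℕ, W * (((1 + A) * W) ^ k * (((M : ℝ) + 1) ^ (k + 1))⁻¹ -
        (A * W) ^ k * (((M : ℝ) + 1) ^ (k + 1))⁻¹) =
        ((1 + A) ^ k - A ^ k) * W ^ (k + 1) * (((M : ℝ) + 1) ^ (k + 1))⁻¹ := by
      intro k
      simp only [mul_pow]
      ring
    have hnn : ∀ k : ℕ, 0 ≤ ((1 + A) ^ k - A ^ k) * W ^ (k + 1) := fun k =>
      mul_nonneg (one_add_pow_sub_pow_nonneg hA k) (by positivity)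
    simp only [hf] at hs
    rw [he, ← hs.tsum_eq, ENNReal.ofReal_tsum_of_nonneg
      (fun k => mul_nonneg (hnn k) (by positivity)) hs.summable]
    exact tsum_congr fun k => ENNReal.ofReal_mul (hnn k)
  simp only [h1]
  rw [ENNReal.tsum_comm, tsum_eq_zero_add' (f := fun w => ENNReal.ofReal (psiCoeff A w * W ^ w))
    ENNReal.summable]
  simp only [psiCoeff, zero_mul, ENNReal.ofReal_zero, zero_add]
  refine tsum_congr fun k => ?_
  rw [ENNReal.tsum_mul_left]
  rcases Nat.eq_zero_or_pos k with rfl | hk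
  · simp
  · rw [tsum_ofReal_inv_pow_eq_zetaVal (by omega), mul_assoc,
      ENNReal.ofReal_mul (zetaVal_nonneg _), mul_comm]

lemma prodSum_one_ne_top {A W : ℝ} (hW : 0 ≤ W) (hW1 : W < 1) (hAW : (1 + A) * W ≤ 1 / 2) :
    prodSum A W 1 ≠ ⊤ := by
  have hy : 1 / 2 ≤ 1 - (1 + A) * W := by linarith
  rw [prodSum]
  simp only [prodTerm_one_eq_pochTerm hW1 hAW]
  rw [← ENNReal.ofReal_tsum_of_nonneg (pochTerm_nonneg hW1.le hy) (summable_pochTerm hW hW1.le hy)]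
  exact ENNReal.ofReal_ne_top

lemma starTail_ne_top {w : ℕ} (c : Composition w) (hc : 2 ≤ c.blocks.getLastD 0) :
    starTail c.blocks 1 ≠ ⊤ := by
  intro htop
  have hsum := tsum_composition_starWeight (A := 1) (W := 1 / 4) zero_le_one (by norm_num)
    (by norm_num)
  have hfin := prodSum_one_ne_top (A := 1) (W := 1 / 4) (by norm_num) (by norm_num) (by norm_num)
  rw [← hsum] at hfin
  have h1 := ENNReal.ne_top_of_tsum_ne_top hfin w
  have h2 := (ENNReal.sum_ne_top.1 h1) c (Finset.mem_univ c)
  rw [starWeight, if_pos hc, htop, ENNReal.mul_top (by simp)] at h2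
  exact h2 rfl

/-- The value at `A` of the coefficient of `W ^ w` in the generating function of zeta-star
values. -/
noncomputable def starCoeff (A : ℝ) (w : ℕ) : ℝ :=
  ∑ c : Composition w,
    if 2 ≤ c.blocks.getLastD 0 then mzvStar c.blocks * A ^ (c.length - 1) else 0

lemma starCoeff_nonneg {A : ℝ} (hA : 0 ≤ A) (w : ℕ) : 0 ≤ starCoeff A w := by
  refine Finset.sum_nonneg fun c _ => ?_
  have := mzvStar_nonneg c.blocks
  split_ifs <;> positivity

lemma sum_starWeight_eq {A W : ℝ} (hA : 0 ≤ A) (hW : 0 ≤ W) (w : ℕ) :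
    ∑ c : Composition w, starWeight A W 1 c.blocks = ENNReal.ofReal (starCoeff A w * W ^ w) := by
  rw [starCoeff, Finset.sum_mul, ENNReal.ofReal_sum_of_nonneg]
  · refine Finset.sum_congr rfl fun c _ => ?_
    unfold starWeight
    split_ifs with hc
    · rw [mzvStar_eq_toReal, c.blocks_sum, mul_assoc, ENNReal.ofReal_mul ENNReal.toReal_nonneg,
        ENNReal.ofReal_toReal (starTail_ne_top c hc), mul_comm]
    · simp
  · intro c _
    have := mzvStar_nonneg c.blocks
    split_ifs <;> positivity

lemma eq_of_tsum_ofReal_mul_pow_eq {a b : ℕ → ℝ} (ha : ∀ n, 0 ≤ a n) (hb : ∀ n, 0 ≤ b n) {δ : ℝ}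
    (hδ : 0 < δ)
    (heq : ∀ x, 0 ≤ x → x ≤ δ →
      ∑' n, ENNReal.ofReal (a n * x ^ n) = ∑' n, ENNReal.ofReal (b n * x ^ n))
    (hfin : ∑' n, ENNReal.ofReal (a n * δ ^ n) ≠ ⊤) : a = b := by
  have aux : ∀ d : ℕ → ℝ, (∀ n, 0 ≤ d n) → ∑' n, ENNReal.ofReal (d n * δ ^ n) ≠ ⊤ →
      HasFPowerSeriesAt (FormalMultilinearSeries.ofScalarsSum d : ℝ → ℝ)
        (FormalMultilinearSeries.ofScalars ℝ d) 0 := by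
    intro d hd hdf
    have hs : Summable fun n => d n * δ ^ n := by
      have := ENNReal.summable_toReal hdf
      refine this.congr fun n => ENNReal.toReal_ofReal (mul_nonneg (hd n) (by positivity))
    have hr : (δ.toNNReal : ℝ≥0∞) ≤ (FormalMultilinearSeries.ofScalars ℝ d).radius := by
      refine FormalMultilinearSeries.le_radius_of_summable _ (hs.congr fun n => ?_)
      rw [FormalMultilinearSeries.ofScalars_norm, Real.norm_of_nonneg (hd n),
        Real.coe_toNNReal _ hδ.le]
    refine ((FormalMultilinearSeries.ofScalars ℝ d).hasFPowerSeriesOnBall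
      (lt_of_lt_of_le ?_ hr)).hasFPowerSeriesAt
    simpa using hδ
  have hpa := aux a ha hfin
  have hpb := aux b hb (heq δ hδ.le le_rfl ▸ hfin)
  have hfreq : ∃ᶠ x in nhdsWithin (0 : ℝ) {0}ᶜ,
      (FormalMultilinearSeries.ofScalarsSum a : ℝ → ℝ) x =
        FormalMultilinearSeries.ofScalarsSum b x := by
    have hev : ∀ᶠ x in nhdsWithin (0 : ℝ) (Set.Ioi 0),
        (FormalMultilinearSeries.ofScalarsSum a : ℝ → ℝ) x =
          FormalMultilinearSeries.ofScalarsSum b x := by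
      filter_upwards [Ioc_mem_nhdsGT hδ] with x hx
      have h := congrArg ENNReal.toReal (heq x hx.1.le hx.2)
      rw [ENNReal.tsum_toReal_eq (fun _ => ENNReal.ofReal_ne_top),
        ENNReal.tsum_toReal_eq (fun _ => ENNReal.ofReal_ne_top)] at h
      have hx0 := hx.1
      simp only [ENNReal.toReal_ofReal (mul_nonneg (ha _) (pow_nonneg hx0.le _)),
        ENNReal.toReal_ofReal (mul_nonneg (hb _) (pow_nonneg hx0.le _))] at h
      simpa only [FormalMultilinearSeries.ofScalars_sum_eq, smul_eq_mul] using h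
    exact hev.frequently.filter_mono (nhdsWithin_mono _ fun x hx => (ne_of_gt hx))
  have hev := (hpa.analyticAt.frequently_eq_iff_eventually_eq hpb.analyticAt).1 hfreq
  exact FormalMultilinearSeries.ofScalars_series_injective ℝ ℝ
    (hpa.eq_formalMultilinearSeries (hpb.congr (hev.mono fun x hx => hx.symm)))

lemma starCoeff_eq_psiCoeff {A : ℝ} (hA : 0 ≤ A) (hA1 : A ≤ 1) : starCoeff A = psiCoeff A := by
  have hle : ∀ W : ℝ, 0 ≤ W → W ≤ 1 / 4 → (1 + A) * W ≤ 1 / 2 := fun W hW hW4 => by nlinarith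
  have hsum : ∀ W : ℝ, 0 ≤ W → W ≤ 1 / 4 →
      ∑' w, ENNReal.ofReal (starCoeff A w * W ^ w) = prodSum A W 1 := by
    intro W hW hW4
    simp only [← sum_starWeight_eq hA hW]
    exact tsum_composition_starWeight hA hW ((hle W hW hW4).trans_lt (by norm_num))
  refine eq_of_tsum_ofReal_mul_pow_eq (δ := 1 / 4) (starCoeff_nonneg hA) (psiCoeff_nonneg hA)
    (by norm_num) (fun W hW hW4 => ?_) ?_
  · rw [hsum W hW hW4, prodSum_one_eq hW (by linarith) (hle W hW hW4),
      tsum_psiCoeff hA hW ((hle W hW hW4).trans_lt (by norm_num))]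
  · rw [hsum _ (by norm_num) le_rfl]
    exact prodSum_one_ne_top (by norm_num) (by norm_num) (hle _ (by norm_num) le_rfl)

/-- Generating function form of the sum formula for multiple zeta-star values:
`Σ_{k, a ≥ 2} ζ*(k,a) A^{dep k} W^{|k|+a} = W(ψ₁((1+A)W) − ψ₁(AW))`.
The coefficient of `W^w` on the left-hand side is the sum of `ζ*(k₁,…,k_r,a) A^r`
over all compositions `(k₁,…,k_r,a)` of `w` with `a ≥ 2`. -/
theorem gen_func_mzvStar_sum_formula :
    (PowerSeries.mk fun w =>
        ∑ c : Composition w,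
          if 2 ≤ c.blocks.getLastD 0 then
            Polynomial.C (mzvStar c.blocks) * Polynomial.X ^ (c.length - 1)
          else 0) =
    PowerSeries.X * (psi1At (1 + Polynomial.X) - psi1At Polynomial.X) := by
  ext1 w
  refine Polynomial.eq_of_infinite_eval_eq _ _
    ((Set.Icc_infinite (zero_lt_one (α := ℝ))).mono fun A hA => ?_)
  have h := congrFun (starCoeff_eq_psiCoeff hA.1 hA.2) w
  have hl : Polynomial.eval A (∑ c : Composition w,
      if 2 ≤ c.blocks.getLastD 0 then
        Polynomial.C (mzvStar c.blocks) * Polynomial.X ^ (c.length - 1)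
      else 0) = starCoeff A w := by
    rw [Polynomial.eval_finsetSum, starCoeff]
    refine Finset.sum_congr rfl fun c _ => ?_
    split_ifs <;> simp
  rw [Set.mem_ofPred_eq, PowerSeries.coeff_mk, hl, h]
  cases w with
  | zero => simp [psiCoeff]
  | succ k =>
    rw [PowerSeries.coeff_succ_X_mul, map_sub, psi1At, psi1At, PowerSeries.coeff_mk,
      PowerSeries.coeff_mk, psiCoeff]
    split_ifs with hk
    · simp [hk]
    · simp [mul_sub]
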